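/- If a word w is derivable from the axiom S of a CFG G, then the automaton A(G) accepts some word w′ with Π(w′) = Π(w). Consequently, the language accepted by A(G) has the same Parikh image as L(G), i.e., A(G) is a Parikh-equivalent automaton for G. -/

import Mathlib

/-- The list of variable occurrences (in order) in the right-hand side of a rule. -/
def ruleVars {T N : Type*} (r : ContextFreeRule T N) : List N :=
  r.output.filterMap (fun s => match s with
    | Symbol.nonterminal B => some B
    | _ => none)

/-- The word `w₀w₁⋯w_r` of terminals (in order) in the right-hand side of a rule. -/
def ruleTerms {T N : Type*} (r : ContextFreeRule T N) : List T :=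
  r.output.filterMap (fun s => match s with
    | Symbol.terminal a => some a
    | _ => none)

/-- A reminder pair: a `Current` component in `V ∪ {⊥}` (modelled as `Option`,
with `none` playing the role of `⊥`) and a `Followup` multiset over the variables. -/
abbrev RPair {T : Type*} (g : ContextFreeGrammar T) : Type _ :=
  Option g.NT × Multiset g.NT

/-- A reminder sequence: a finite sequence of reminder pairs. -/
abbrev RSeq {T : Type*} (g : ContextFreeGrammar T) : Type _ := List (RPair g)

/-- The five transition rules of the automaton `A(G)`; a transition reads a word
over the terminals. -/
inductive Step {T : Type*} (g : ContextFreeGrammar T) [DecidableEq g.NT] :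
    RSeq g → List T → RSeq g → Prop where
  /-- (1) `RS·(A,∅) ⟹ RS·(A_j, ⟦A₁,…,A_r⟧ ⊖ ⟦A_j⟧)` reading `w₀w₁⋯w_r`,
  for a production `A → w₀A₁w₁⋯A_r w_r` with `r ≥ 1`. -/
  | ext (RS : RSeq g) (r : ContextFreeRule T g.NT) (hr : r ∈ g.rules)
      (Aj : g.NT) (hAj : Aj ∈ ruleVars r) :
      Step g (RS ++ [(some r.input, 0)]) (ruleTerms r)
        (RS ++ [(some Aj, (ruleVars r : Multiset g.NT).erase Aj)])
  /-- (2) `RS·(A,v) ⟹ RS·(A,v)·(A_j, ⟦A₁,…,A_r⟧ ⊖ ⟦A_j⟧)` when `v ≠ ∅`. -/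
  | extNe (RS : RSeq g) (r : ContextFreeRule T g.NT) (hr : r ∈ g.rules)
      (v : Multiset g.NT) (hv : v ≠ 0) (Aj : g.NT) (hAj : Aj ∈ ruleVars r) :
      Step g (RS ++ [(some r.input, v)]) (ruleTerms r)
        (RS ++ [(some r.input, v), (some Aj, (ruleVars r : Multiset g.NT).erase Aj)])
  /-- (3) `RS·(A,∅) ⟹ RS·(⊥,∅)` reading `w`, for a production `A → w`. -/
  | replE (RS : RSeq g) (r : ContextFreeRule T g.NT) (hr : r ∈ g.rules)
      (hterm : ruleVars r = []) :
      Step g (RS ++ [(some r.input, 0)]) (ruleTerms r) (RS ++ [(none, 0)])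
  /-- (4) `RS·(A, v ⊕ ⟦A′⟧) ⟹ RS·(A′, v)` reading `w`, for a production `A → w`. -/
  | replNe (RS : RSeq g) (r : ContextFreeRule T g.NT) (hr : r ∈ g.rules)
      (hterm : ruleVars r = []) (v : Multiset g.NT) (A' : g.NT) :
      Step g (RS ++ [(some r.input, v + {A'})]) (ruleTerms r) (RS ++ [(some A', v)])
  /-- (5) `RS·(A, v ⊕ ⟦A′⟧)·(⊥,∅) ⟹ RS·(A′, v)` reading `ε`. -/
  | shorten (RS : RSeq g) (A : g.NT) (v : Multiset g.NT) (A' : g.NT) :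
      Step g (RS ++ [(some A, v + {A'}), (none, 0)]) [] (RS ++ [(some A', v)])

/-- The state constraint of `A(G)`: every variable occurs at most twice (as a
`Current` component) in the reminder sequence. -/
def Ok {T : Type*} (g : ContextFreeGrammar T) [DecidableEq g.NT] (RS : RSeq g) : Prop :=
  ∀ A : g.NT, (RS.map Prod.fst).count (some A) ≤ 2

/-- Multi-step runs of `A(G)` through states of the automaton, concatenating the
words read. -/
inductive Steps {T : Type*} (g : ContextFreeGrammar T) [DecidableEq g.NT] :
    RSeq g → List T → RSeq g → Prop where
  | refl (RS : RSeq g) (h : Ok g RS) : Steps g RS [] RS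
  | tail {RS₁ RS₂ RS₃ : RSeq g} {w w' : List T} (h : Steps g RS₁ w RS₂)
      (hstep : Step g RS₂ w' RS₃) (h3 : Ok g RS₃) : Steps g RS₁ (w ++ w') RS₃

/-- The initial state `(S, ∅)` of `A(G)`. -/
def start {T : Type*} (g : ContextFreeGrammar T) : RSeq g := [(some g.initial, 0)]

/-- A reminder sequence is a (reachable) state of `A(G)` if it can be reached from
the initial state `(S, ∅)`. -/
def ReachableState {T : Type*} (g : ContextFreeGrammar T) [DecidableEq g.NT]
    (RS : RSeq g) : Prop :=
  ∃ w : List T, Steps g (start g) w RS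

/-- `A(G)` accepts the word `w`: it can go from the initial state `(S,∅)` to the
final state `(⊥,∅)` reading `w`. -/
def AutAccepts {T : Type*} (g : ContextFreeGrammar T) [DecidableEq g.NT]
    (w : List T) : Prop :=
  Steps g (start g) w [(none, 0)]

/-- The Parikh image of a word. -/
def parikh {T : Type*} [DecidableEq T] (w : List T) : T → ℕ := fun σ => w.count σ

/-- Forests in first-child / next-sibling encoding. -/
inductive Fo (R : Type*) where
  | nil : Fo R
  | cons (r : R) (c s : Fo R) : Fo R

/-- One-hole contexts. -/
inductive Cx (R : Type*) where
  | here (s : Fo R) : Cx R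
  | sib (r : R) (c : Fo R) (K : Cx R) : Cx R
  | child (r : R) (K : Cx R) (s : Fo R) : Cx R

namespace Fo

variable {R N : Type*}

def roots (inp : R → N) : Fo R → Multiset N
  | nil => 0
  | cons r _ s => inp r ::ₘ roots inp s

def prods : Fo R → Multiset R
  | nil => 0
  | cons r c s => r ::ₘ (prods c + prods s)

def Valid (inp : R → N) (vs : R → Multiset N) : Fo R → Prop
  | nil => True
  | cons r c s => roots inp c = vs r ∧ Valid inp vs c ∧ Valid inp vs s

def app : Fo R → Fo R → Fo R
  | nil, f => f
  | cons r c s, f => cons r c (app s f)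

def wt (e : ℚ) : Fo R → ℚ
  | nil => 1
  | cons _ _ _ => e

def phi (e : ℚ) : Fo R → ℚ
  | nil => 0
  | cons r c s => wt e s * (1 + phi e c) + phi e s

def Good [DecidableEq N] (inp : R → N) : Multiset N → Fo R → Prop
  | _, nil => True
  | m, cons r c nil => m.count (inp r) ≤ 1 ∧ Good inp m c
  | m, cons r c (cons r' c' s') => m.count (inp r) ≤ 1 ∧ Good inp (inp r ::ₘ m) c ∧
      Good inp m (cons r' c' s')

def plug (r : R) (c : Fo R) : Cx R → Fo R
  | .here s => cons r c s
  | .sib r' c' K => cons r' c' (plug r c K)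
  | .child r' K s => cons r' (plug r c K) s

def plugL (r : R) (c : Fo R) : Cx R → Fo R
  | .here s => app s (cons r c nil)
  | .sib r' c' K => cons r' c' (plugL r c K)
  | .child r' K s => app s (cons r' (plugL r c K) nil)

def coef (e : ℚ) : Cx R → ℚ
  | .here s => wt e s
  | .sib _ _ K => coef e K
  | .child _ K s => wt e s * coef e K

def base (e : ℚ) : Cx R → ℚ
  | .here s => phi e s
  | .sib _ c K => e * (1 + phi e c) + base e K
  | .child _ K s => wt e s * (1 + base e K) + phi e s

def prodsK : Cx R → Multiset R
  | .here s => prods s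
  | .sib r c K => r ::ₘ (prods c + prodsK K)
  | .child r K s => r ::ₘ (prodsK K + prods s)

def occ (inp : R → N) : Cx R → Multiset N
  | .here _ => 0
  | .sib _ _ K => occ inp K
  | .child _ K nil => occ inp K
  | .child r K (cons _ _ _) => inp r ::ₘ occ inp K

lemma wt_pos {e : ℚ} (he : 0 < e) (f : Fo R) : 0 < wt e f := by
  cases f <;> simp [wt, he]

lemma wt_le {e : ℚ} (he : e ≤ 1) (f : Fo R) : wt e f ≤ 1 := by
  cases f <;> simp [wt, he]

lemma phi_nonneg {e : ℚ} (he : 0 < e) (f : Fo R) : 0 ≤ phi e f := by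
  induction f with
  | nil => simp [phi]
  | cons r c s hc hs =>
    have := wt_pos he s
    simp only [phi]; positivity

lemma phi_le {e : ℚ} (he : 0 < e) (he1 : e ≤ 1) (f : Fo R) :
    phi e f ≤ (Multiset.card (prods f) : ℚ) := by
  induction f with
  | nil => simp [phi, prods]
  | cons r c s hc hs =>
    have h1 := wt_le he1 s
    have h0 := phi_nonneg he c
    simp only [phi, prods, Multiset.card_cons, Multiset.card_add]
    push_cast
    nlinarith

lemma coef_pos {e : ℚ} (he : 0 < e) (K : Cx R) : 0 < coef e K := by
  induction K with
  | here s => exact wt_pos he s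
  | sib r c K ih => exact ih
  | child r K s ih => exact mul_pos (wt_pos he s) ih

lemma wt_plug (e : ℚ) (r : R) (c : Fo R) (K : Cx R) : wt e (plug r c K) = e := by
  cases K <;> simp [plug, wt]

lemma phi_plug (e : ℚ) (r : R) (c : Fo R) (K : Cx R) :
    phi e (plug r c K) = base e K + coef e K * (1 + phi e c) := by
  induction K with
  | here s => simp only [plug, phi, base, coef]; ring
  | sib r' c' K ih => simp only [plug, phi, base, coef, ih, wt_plug]; ring
  | child r' K s ih => simp only [plug, phi, base, coef, ih]; ring

lemma phi_app {e : ℚ} (he : 0 < e) (f h : Fo R) : phi e h ≤ phi e (app f h) := by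
  induction f with
  | nil => simp [app]
  | cons r c s hc hs =>
    have := wt_pos he (app s h)
    have := phi_nonneg he c
    have : 0 ≤ wt e (app s h) * (1 + phi e c) := by positivity
    simp only [app, phi]; linarith

lemma phi_plugL {e : ℚ} (he : 0 < e) (r : R) (c : Fo R) (K : Cx R) :
    1 + phi e c ≤ phi e (plugL r c K) := by
  induction K with
  | here s =>
    refine le_trans ?_ (phi_app he _ _)
    simp [phi, wt]
  | sib r' c' K ih =>
    have := wt_pos he (plugL r c K)
    have := phi_nonneg he c'
    have : 0 ≤ wt e (plugL r c K) * (1 + phi e c') := by positivity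
    simp only [plugL, phi]; linarith
  | child r' K s ih =>
    refine le_trans ?_ (phi_app he _ _)
    simp [phi, wt]; linarith

lemma prods_app (f h : Fo R) : prods (app f h) = prods f + prods h := by
  induction f with
  | nil => simp [app, prods]
  | cons r c s hc hs => simp [app, prods, hs, add_assoc]

lemma roots_app (inp : R → N) (f h : Fo R) :
    roots inp (app f h) = roots inp f + roots inp h := by
  induction f with
  | nil => simp [app, roots]
  | cons r c s hc hs => simp [app, roots, hs]

lemma valid_app (inp : R → N) (vs) (f h : Fo R) :
    Valid inp vs (app f h) ↔ Valid inp vs f ∧ Valid inp vs h := by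
  induction f with
  | nil => simp [app, Valid]
  | cons r c s hc hs => simp [app, Valid, hs, and_assoc]

lemma prods_plug (r : R) (c : Fo R) (K : Cx R) :
    prods (plug r c K) = prodsK K + r ::ₘ prods c := by
  induction K with
  | here s => simp [plug, prods, prodsK, add_comm]
  | sib r' c' K ih => simp [plug, prods, prodsK, ih, Multiset.cons_swap, add_assoc]
  | child r' K s ih =>
    simp only [plug, prods, prodsK, ih, ← Multiset.singleton_add]; abel

lemma prods_plugL (r : R) (c : Fo R) (K : Cx R) :
    prods (plugL r c K) = prodsK K + r ::ₘ prods c := by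
  induction K with
  | here s => simp [plugL, prods, prodsK, prods_app]
  | sib r' c' K ih => simp [plugL, prods, prodsK, ih, Multiset.cons_swap, add_assoc]
  | child r' K s ih =>
    simp only [plugL, prods, prodsK, ih, prods_app, ← Multiset.singleton_add]; abel

lemma roots_plug (inp : R → N) (r r' : R) (c c' : Fo R) (h : inp r = inp r') (K : Cx R) :
    roots inp (plug r c K) = roots inp (plug r' c' K) := by
  induction K with
  | here s => simp [plug, roots, h]
  | sib r' c' K ih => simp [plug, roots, ih]
  | child r' K s ih => simp [plug, roots]

lemma roots_plugL (inp : R → N) (r : R) (c : Fo R) (K : Cx R) :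
    roots inp (plugL r c K) = roots inp (plug r c K) := by
  induction K with
  | here s => simp [plug, plugL, roots, roots_app, ← Multiset.singleton_add, add_comm]
  | sib r' c' K ih => simp [plug, plugL, roots, ih]
  | child r' K s ih => simp [plug, plugL, roots, roots_app, ← Multiset.singleton_add, add_comm]

lemma valid_of_plug (inp : R → N) (vs) (r : R) (c : Fo R) (K : Cx R)
    (h : Valid inp vs (plug r c K)) : roots inp c = vs r ∧ Valid inp vs c := by
  induction K with
  | here s => exact ⟨h.1, h.2.1⟩
  | sib r' c' K ih => exact ih h.2.2
  | child r' K s ih => exact ih h.2.1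

lemma valid_plug (inp : R → N) (vs) (r r' : R) (c c' : Fo R) (K : Cx R)
    (h : Valid inp vs (plug r c K)) (hr : inp r = inp r') (h1 : roots inp c' = vs r')
    (h2 : Valid inp vs c') : Valid inp vs (plug r' c' K) := by
  induction K with
  | here s => exact ⟨h1, h2, h.2.2⟩
  | sib r' c' K ih => exact ⟨h.1, h.2.1, ih h.2.2⟩
  | child r₂ K s ih => exact ⟨(roots_plug inp r r' c c' hr K) ▸ h.1, ih h.2.1, h.2.2⟩

lemma valid_plugL (inp : R → N) (vs) (r : R) (c : Fo R) (K : Cx R)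
    (h : Valid inp vs (plug r c K)) : Valid inp vs (plugL r c K) := by
  induction K with
  | here s => exact (valid_app _ _ _ _).2 ⟨h.2.2, h.1, h.2.1, trivial⟩
  | sib r' c' K ih => exact ⟨h.1, h.2.1, ih h.2.2⟩
  | child r' K s ih =>
    exact (valid_app _ _ _ _).2 ⟨h.2.2, (roots_plugL inp r c K).trans h.1, ih h.2.1, trivial⟩

lemma not_good [DecidableEq N] (inp : R → N) (f : Fo R) : ∀ m, ¬ Good inp m f →
    ∃ r c K, f = plug r c K ∧ 2 ≤ (m + occ inp K).count (inp r) := by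
  induction f with
  | nil => intro m h; exact absurd trivial h
  | cons r c s hc hs =>
    intro m h
    by_cases h1 : m.count (inp r) ≤ 1
    · cases s with
      | nil =>
        simp only [Good, h1, true_and] at h
        obtain ⟨r', c', K, rfl, hK⟩ := hc _ h
        exact ⟨r', c', .child r K nil, rfl, by simpa [occ] using hK⟩
      | cons r₁ c₁ s₁ =>
        simp only [Good, h1, true_and] at h
        by_cases h2 : Good inp (inp r ::ₘ m) c
        · obtain ⟨r', c', K, hE, hK⟩ := hs m (fun h3 => h ⟨h2, h3⟩)
          exact ⟨r', c', .sib r c K, by simp [plug, hE], by simpa [occ] using hK⟩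
        · obtain ⟨r', c', K, rfl, hK⟩ := hc _ h2
          exact ⟨r', c', .child r K (cons r₁ c₁ s₁), rfl, by simpa [occ] using hK⟩
    · exact ⟨r, c, .here s, rfl, by simp [occ]; omega⟩

lemma split_cx [DecidableEq N] (inp : R → N) {e : ℚ} (he : 0 < e) (he1 : e ≤ 1) (A : N)
    (K : Cx R) (h : 1 ≤ (occ inp K).count A) :
    ∃ K0 r1 K1, inp r1 = A ∧ (∀ r c, plug r c K = plug r1 (plug r c K1) K0) ∧
      coef e K0 ≤ e ∧ (occ inp K).count A = (occ inp K1).count A + 1 := by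
  induction K with
  | here s => simp [occ] at h
  | sib r c K ih =>
    obtain ⟨K0, r1, K1, h1, h2, h3, h4⟩ := ih h
    exact ⟨.sib r c K0, r1, K1, h1, fun r c => by simp [plug, h2], h3, h4⟩
  | child r K s ih =>
    have key : 1 ≤ (occ inp K).count A → (occ inp (.child r K s)).count A = (occ inp K).count A →
        ∃ K0 r1 K1, inp r1 = A ∧ (∀ r' c, plug r' c (.child r K s) = plug r1 (plug r' c K1) K0) ∧
      coef e K0 ≤ e ∧ (occ inp (.child r K s)).count A = (occ inp K1).count A + 1 := by
      intro h5 h6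
      obtain ⟨K0, r1, K1, h1, h2, h3, h4⟩ := ih h5
      refine ⟨.child r K0 s, r1, K1, h1, fun r c => by simp [plug, h2], ?_, by rw [h6, h4]⟩
      have := wt_le he1 s
      have := wt_pos he s
      have := coef_pos he K0
      simp only [coef]; nlinarith
    cases s with
    | nil => exact key h rfl
    | cons r₁ c₁ s₁ =>
      by_cases hA : inp r = A
      · exact ⟨.here (cons r₁ c₁ s₁), r, K, hA, fun _ _ => rfl, le_rfl, by simp [occ, hA]⟩
      · have : (occ inp (.child r K (cons r₁ c₁ s₁))).count A = (occ inp K).count A := by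
          simp [occ, Multiset.count_cons, Ne.symm hA]
        exact key (this ▸ h) this

lemma improve [DecidableEq N] (inp : R → N) (vs) {e : ℚ} (he : 0 < e) (he1 : e ≤ 1)
    (f : Fo R) (hf : Valid inp vs f) (hsz : e * (Multiset.card (prods f) : ℚ) < 1)
    (hg : ¬ Good inp 0 f) :
    ∃ f', Valid inp vs f' ∧ roots inp f' = roots inp f ∧ prods f' = prods f ∧
      phi e f < phi e f' := by
  obtain ⟨r3, c3, K, rfl, hK⟩ := not_good inp f 0 hg
  rw [zero_add] at hK
  obtain ⟨K0, r1, K', h1, hp, -, hc⟩ := split_cx inp he he1 (inp r3) K (by omega)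
  obtain ⟨K1, r2, K2, h2, hp2, hco, -⟩ := split_cx inp he he1 (inp r3) K' (by omega)
  rw [hp, hp2] at *
  set u3 := plug r3 c3 K2
  obtain ⟨a1, a2⟩ := valid_of_plug inp vs _ _ _ hf
  obtain ⟨b1, b2⟩ := valid_of_plug inp vs _ _ _ a2
  obtain ⟨d1, d2⟩ := valid_of_plug inp vs _ _ _ b2
  have V1 : Valid inp vs (plug r3 c3 K1) := valid_plug inp vs _ _ _ _ _ a2 h2 d1 d2
  have R1 : roots inp (plug r3 c3 K1) = vs r1 := (roots_plug inp _ _ _ _ h2.symm K1).trans a1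
  have V2 : Valid inp vs (plug r1 (plug r3 c3 K1) K2) :=
    valid_plug inp vs _ _ _ _ _ b2 h1.symm R1 V1
  have V3 := valid_plugL inp vs _ _ _ V2
  have R3 : roots inp (plugL r1 (plug r3 c3 K1) K2) = vs r2 := by
    rw [roots_plugL, roots_plug inp r1 r3 _ c3 h1 K2]; exact b1
  refine ⟨plug r2 (plugL r1 (plug r3 c3 K1) K2) K0,
    valid_plug inp vs _ _ _ _ _ hf (h1.trans h2.symm) R3 V3,
    roots_plug inp _ _ _ _ (h2.trans h1.symm) K0, ?_, ?_⟩
  · simp only [u3, prods_plug, prods_plugL, ← Multiset.singleton_add]; abel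
  · have q1 := phi_plugL he r1 (plug r3 c3 K1) K2
    have q2 := phi_le he he1 u3
    have q3 := phi_nonneg he u3
    have q4 := phi_nonneg he c3
    have q5 := coef_pos he K1
    have q6 := coef_pos he K0
    have q7 : (1 + phi e u3) ≤
        (Multiset.card (prods (plug r1 (plug r2 u3 K1) K0)) : ℚ) := by
      simp only [prods_plug r1, prods_plug r2, Multiset.card_add, Multiset.card_cons]
      push_cast
      have z1 : (0:ℚ) ≤ (Multiset.card (prodsK K0) : ℚ) := by positivity
      have z2 : (0:ℚ) ≤ (Multiset.card (prodsK K1) : ℚ) := by positivity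
      linarith
    have q8 : coef e K1 * (1 + phi e u3) < 1 := by
      calc _ ≤ e * (1 + phi e u3) := by gcongr
        _ ≤ _ := mul_le_mul_of_nonneg_left q7 he.le
        _ < 1 := hsz
    rw [phi_plug e r1, phi_plug e r2 _ K0, phi_plug e r2]
    rw [phi_plug e r3] at q1
    have q9 : 0 < coef e K1 * (1 + phi e c3) := by positivity
    have : base e K1 + coef e K1 * (1 + phi e u3) < phi e (plugL r1 (plug r3 c3 K1) K2) := by
      linarith
    nlinarith

lemma finite_fo (S : Set R) (hS : S.Finite) (n : ℕ) :
    {f : Fo R | Multiset.card (prods f) ≤ n ∧ ∀ r ∈ prods f, r ∈ S}.Finite := by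
  induction n with
  | zero =>
    refine (Set.finite_singleton (nil : Fo R)).subset ?_
    rintro (_ | ⟨r, c, s⟩) ⟨h, -⟩
    · rfl
    · simp [prods] at h
  | succ n ih =>
    refine ((Set.finite_singleton (nil : Fo R)).union
      ((hS.prod (ih.prod ih)).image (fun p => cons p.1 p.2.1 p.2.2))).subset ?_
    rintro (_ | ⟨r, c, s⟩) ⟨h, h'⟩
    · left; rfl
    · right
      simp only [prods, Multiset.card_cons, Multiset.card_add, Multiset.mem_cons,
        Multiset.mem_add] at h h'
      exact ⟨(r, c, s), ⟨h' r (Or.inl rfl), ⟨by show Multiset.card (prods c) ≤ n; omega, fun x hx => h' x (by tauto)⟩,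
        ⟨by show Multiset.card (prods s) ≤ n; omega, fun x hx => h' x (by tauto)⟩⟩, rfl⟩

lemma exists_good [DecidableEq N] (inp : R → N) (vs) (S : Set R) (hS : S.Finite)
    (f : Fo R) (hf : Valid inp vs f) (hfS : ∀ r ∈ prods f, r ∈ S) :
    ∃ f', Valid inp vs f' ∧ roots inp f' = roots inp f ∧ prods f' = prods f ∧
      Good inp 0 f' := by
  set n := Multiset.card (prods f) with hn
  set e : ℚ := 1 / (n + 1) with hee
  have he : 0 < e := by positivity
  have he1 : e ≤ 1 := by
    rw [hee, div_le_one (by positivity)]; linarith [(Nat.cast_nonneg n : (0:ℚ) ≤ n)]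
  have hen : e * n < 1 := by
    rw [hee, div_mul_eq_mul_div, div_lt_one (by positivity)]; linarith
  have hfin : {f' : Fo R | Valid inp vs f' ∧ roots inp f' = roots inp f ∧
      prods f' = prods f}.Finite := by
    refine (finite_fo S hS n).subset ?_
    rintro f' ⟨-, -, h⟩
    exact ⟨by rw [h], by rw [h]; exact hfS⟩
  obtain ⟨f', ⟨h1, h2, h3⟩, hmax⟩ := Set.exists_max_image _ (phi e) hfin ⟨f, hf, rfl, rfl⟩
  refine ⟨f', h1, h2, h3, ?_⟩
  by_contra hg
  obtain ⟨f'', k1, k2, k3, k4⟩ := improve inp vs he he1 f' h1 (by rw [h3]; exact hen) hg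
  exact absurd (hmax f'' ⟨k1, k2.trans h2, k3.trans h3⟩) (not_le.2 k4)

lemma split_fo (inp : R → N) (vs) (f : Fo R) (hf : Valid inp vs f) : ∀ a b : Multiset N,
    roots inp f = a + b → ∃ f1 f2, roots inp f1 = a ∧ roots inp f2 = b ∧
      prods f = prods f1 + prods f2 ∧ Valid inp vs f1 ∧ Valid inp vs f2 := by
  induction f with
  | nil =>
    intro a b h
    have h : a + b = 0 := h.symm
    obtain ⟨rfl, rfl⟩ : a = 0 ∧ b = 0 := by simpa using h
    exact ⟨nil, nil, rfl, rfl, rfl, trivial, trivial⟩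
  | cons r c s hc hs =>
    intro a b h
    have hm : inp r ∈ a + b := by rw [← h]; simp [roots]
    rcases Multiset.mem_add.1 hm with hm | hm
    · obtain ⟨a', rfl⟩ := Multiset.exists_cons_of_mem hm
      obtain ⟨f1, f2, h1, h2, h3, h4, h5⟩ := hs hf.2.2 a' b (by simpa [roots] using h)
      exact ⟨cons r c f1, f2, by simp [roots, h1], h2, by simp [prods, h3, add_assoc],
        ⟨hf.1, hf.2.1, h4⟩, h5⟩
    · obtain ⟨b', rfl⟩ := Multiset.exists_cons_of_mem hm
      obtain ⟨f1, f2, h1, h2, h3, h4, h5⟩ := hs hf.2.2 a b' (by simpa [roots] using h)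
      refine ⟨f1, cons r c f2, h1, by simp [roots, h2], ?_, h4, ⟨hf.1, hf.2.1, h5⟩⟩
      simp only [prods, h3, ← Multiset.singleton_add]; abel

end Fo

section Gram

variable {T : Type*} (g : ContextFreeGrammar T)

def sVars {T N : Type*} (l : List (Symbol T N)) : List N :=
  l.filterMap (fun s => match s with
    | Symbol.nonterminal B => some B
    | _ => none)

def sTerms {T N : Type*} (l : List (Symbol T N)) : List T :=
  l.filterMap (fun s => match s with
    | Symbol.terminal a => some a
    | _ => none)

lemma ruleVars_eq {T N : Type*} (r : ContextFreeRule T N) : ruleVars r = sVars r.output := rfl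
lemma ruleTerms_eq {T N : Type*} (r : ContextFreeRule T N) : ruleTerms r = sTerms r.output := rfl

lemma sVars_append {T N : Type*} (a b : List (Symbol T N)) :
    sVars (a ++ b) = sVars a ++ sVars b := by simp [sVars]
lemma sTerms_append {T N : Type*} (a b : List (Symbol T N)) :
    sTerms (a ++ b) = sTerms a ++ sTerms b := by simp [sTerms]
lemma sVars_nt {T N : Type*} (A : N) : sVars [(Symbol.nonterminal A : Symbol T N)] = [A] := rfl
lemma sTerms_nt {T N : Type*} (A : N) : sTerms [(Symbol.nonterminal A : Symbol T N)] = [] := rfl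
lemma sVars_map {T N : Type*} (w : List T) :
    sVars (w.map (Symbol.terminal : T → Symbol T N)) = [] := by
  induction w with
  | nil => rfl
  | cons a w ih => simpa [sVars] using ih
lemma sTerms_map {T N : Type*} (w : List T) :
    sTerms (w.map (Symbol.terminal : T → Symbol T N)) = w := by
  induction w with
  | nil => rfl
  | cons a w ih => simpa [sTerms] using ih
lemma eq_map_of_sVars {T N : Type*} (l : List (Symbol T N)) (h : sVars l = []) :
    l = (sTerms l).map Symbol.terminal := by
  induction l with
  | nil => rfl
  | cons a l ih =>
    cases a with
    | terminal a =>
      have := ih (by simpa [sVars] using h)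
      simpa [sTerms] using this
    | nonterminal A => simp [sVars] at h

abbrev gVs (r : ContextFreeRule T g.NT) : Multiset g.NT := (ruleVars r : Multiset g.NT)
abbrev gTs (f : Fo (ContextFreeRule T g.NT)) : Multiset T :=
  (f.prods.map (fun r => (ruleTerms r : Multiset T))).sum
abbrev gInp (r : ContextFreeRule T g.NT) : g.NT := r.input

lemma exists_forest (w : List T) (l : List (Symbol T g.NT))
    (h : g.Derives l (w.map Symbol.terminal)) :
    ∃ f : Fo (ContextFreeRule T g.NT), f.Valid (gInp g) (gVs g) ∧ (∀ r ∈ f.prods, r ∈ g.rules) ∧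
      f.roots (gInp g) = (sVars l : Multiset g.NT) ∧
      (sTerms l : Multiset T) + gTs g f = (w : Multiset T) := by
  induction h using Relation.ReflTransGen.head_induction_on with
  | refl =>
    exact ⟨.nil, trivial, by simp [Fo.prods], by simp [Fo.roots, sVars_map],
      by simp [gTs, Fo.prods, sTerms_map]⟩
  | head h _ ih =>
    obtain ⟨f, f1, f2, f3, f4⟩ := ih
    obtain ⟨r, hr, hrw⟩ := h
    obtain ⟨p, q, rfl, rfl⟩ := hrw.exists_parts
    obtain ⟨c, s, k1, k2, k3, k4, k5⟩ := Fo.split_fo (gInp g) (gVs g) f f1 (gVs g r)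
      ((sVars p : Multiset g.NT) + (sVars q : Multiset g.NT)) (by
        rw [f3]; simp only [sVars_append, ← Multiset.coe_add, gVs, ruleVars_eq]; abel)
    refine ⟨.cons r c s, ⟨k1, k4, k5⟩, ?_, ?_, ?_⟩
    · intro x hx
      rcases Multiset.mem_cons.1 hx with rfl | hx
      · exact hr
      · exact f2 x (k3 ▸ hx)
    · simp only [Fo.roots, k2, sVars_append, sVars_nt, ← Multiset.coe_add, gInp,
        ← Multiset.singleton_add, Multiset.coe_singleton]; abel
    · rw [← f4]
      simp only [gTs, Fo.prods, k3, sTerms_append, sTerms_nt, ← Multiset.coe_add,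
        Multiset.map_cons, Multiset.sum_cons, ruleTerms_eq, Multiset.coe_nil]; abel

variable [DecidableEq g.NT]

lemma Steps.trans' {a b c : RSeq g} {w w' : List T} (h : Steps g a w b) (h' : Steps g b w' c) :
    Steps g a (w ++ w') c := by
  induction h' with
  | refl h2 => simpa using h
  | tail h1 hs h3 ih => rw [← List.append_assoc]; exact .tail ih hs h3

lemma Steps.ok {a b : RSeq g} {w : List T} (h : Steps g a w b) : Ok g a := by
  induction h with
  | refl h => exact h
  | tail _ _ _ ih => exact ih

lemma Steps.head' {a b c : RSeq g} {w w' : List T} (ha : Ok g a) (h : Step g a w b)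
    (h' : Steps g b w' c) : Steps g a (w ++ w') c := by
  have h1 : Steps g a ([] ++ w) b := .tail (.refl a ha) h (Steps.ok g h')
  exact Steps.trans' g (by simpa using h1) h'

lemma run_fo (f : Fo (ContextFreeRule T g.NT)) : ∀ (RS : RSeq g) (m : Multiset g.NT),
    (∀ A, (RS.map Prod.fst).count (some A) = m.count A) → (∀ A, m.count A ≤ 2) →
    f.Good (gInp g) m → f.Valid (gInp g) (gVs g) → (∀ r ∈ f.prods, r ∈ g.rules) →
    ∀ r c s, f = .cons r c s →
    ∃ w : List T, (w : Multiset T) = gTs g f ∧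
      Steps g (RS ++ [(some r.input, s.roots (gInp g))]) w (RS ++ [(none, 0)]) := by
  induction f with
  | nil => intro _ _ _ _ _ _ _ r c s h; cases h
  | cons r c s hc hs =>
    intro RS m hm hm2 hg hv hp r₀ c₀ s₀ heq
    cases heq
    have hr : r ∈ g.rules := hp r (by simp [Fo.prods])
    have hpc : ∀ x ∈ c.prods, x ∈ g.rules := fun x hx => hp x (by simp [Fo.prods, hx])
    have hps : ∀ x ∈ s.prods, x ∈ g.rules := fun x hx => hp x (by simp [Fo.prods, hx])
    have hcnt : m.count r.input ≤ 1 := by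
      cases s with
      | nil => exact hg.1
      | cons _ _ _ => exact hg.1
    have hok0 : Ok g (RS ++ [((none : Option g.NT), (0 : Multiset g.NT))]) := by
      intro A; simp [hm, hm2]
    have hcnt2 : ∀ A, (r.input ::ₘ m).count A ≤ 2 := by
      intro A
      rw [Multiset.count_cons]
      have := hm2 A
      split_ifs with h
      · subst h; omega
      · omega
    have hcnt3 : ∀ v A, ((RS ++ [(some r.input, v)]).map Prod.fst).count (some A)
        = (r.input ::ₘ m).count A := by
      intro v A
      rw [Multiset.count_cons, List.map_append, List.count_append, hm]
      by_cases hA : A = r.input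
      · subst hA; simp
      · simp [hA, Ne.symm hA]
    have hok : ∀ v, Ok g (RS ++ [(some r.input, v)]) := by
      intro v A; rw [hcnt3]; exact hcnt2 A
    have hrv := hv.1
    cases c with
    | nil =>
      have hterm : ruleVars r = [] := by
        have : (ruleVars r : Multiset g.NT) = 0 := hrv.symm
        simpa using this
      cases s with
      | nil =>
        refine ⟨ruleTerms r ++ [], by simp [gTs, Fo.prods], ?_⟩
        exact Steps.head' g (hok _) (.replE RS r hr hterm) (.refl _ hok0)
      | cons r' c' s' =>
        obtain ⟨w, hw, hst⟩ := hs RS m hm hm2 hg.2.2 hv.2.2 hps _ _ _ rfl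
        refine ⟨ruleTerms r ++ w, ?_, ?_⟩
        · rw [← Multiset.coe_add, hw]; simp [gTs, Fo.prods]
        · refine Steps.head' g (hok _) ?_ hst
          have := Step.replNe RS r hr hterm (s'.roots (gInp g)) r'.input
          rw [add_comm, Multiset.singleton_add] at this
          exact this
    | cons rc cc sc =>
      have hmem : rc.input ∈ ruleVars r := by
        have : rc.input ∈ (ruleVars r : Multiset g.NT) := by
          have h9 : (ruleVars r : Multiset g.NT) = _ := hrv.symm
          rw [h9]; simp [Fo.roots]
        simpa using this
      have her : (ruleVars r : Multiset g.NT).erase rc.input = sc.roots (gInp g) := by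
        have h9 : (ruleVars r : Multiset g.NT) = _ := hrv.symm
        rw [h9]; simp [Fo.roots]
      cases s with
      | nil =>
        obtain ⟨w, hw, hst⟩ := hc RS m hm hm2 hg.2 hv.2.1 hpc _ _ _ rfl
        refine ⟨ruleTerms r ++ w, ?_, ?_⟩
        · rw [← Multiset.coe_add, hw]; simp [gTs, Fo.prods]
        · refine Steps.head' g (hok _) ?_ hst
          have := Step.ext RS r hr rc.input hmem
          rw [her] at this
          exact this
      | cons r' c' s' =>
        obtain ⟨w', hw', hst'⟩ := hs RS m hm hm2 hg.2.2 hv.2.2 hps _ _ _ rfl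
        obtain ⟨w, hw, hst⟩ := hc (RS ++ [(some r.input, (Fo.cons r' c' s').roots (gInp g))])
          (r.input ::ₘ m) (hcnt3 _) hcnt2 hg.2.1 hv.2.1 hpc _ _ _ rfl
        refine ⟨ruleTerms r ++ (w ++ ([] ++ w')), ?_, ?_⟩
        · simp only [← Multiset.coe_add, hw, hw', List.nil_append]
          simp only [gTs, Fo.prods, Multiset.map_cons, Multiset.map_add, Multiset.sum_cons,
            Multiset.sum_add]
        · refine Steps.head' g (hok _) ?_ (Steps.trans' g hst (Steps.head' g ?_ ?_ hst'))
          · have := Step.extNe RS r hr ((Fo.cons r' c' s').roots (gInp g)) (by simp [Fo.roots])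
              rc.input hmem
            rw [her] at this
            simpa using this
          · intro A
            rw [List.map_append, List.count_append, hcnt3]
            simpa using hcnt2 A
          · have := Step.shorten RS r.input (s'.roots (gInp g)) r'.input
            rw [add_comm, Multiset.singleton_add] at this
            simpa [Fo.roots] using this

def pend (RS : RSeq g) : Multiset g.NT :=
  (RS.map Prod.snd).sum + (match RS.getLast? with
    | some (some A, _) => {A}
    | _ => 0)

lemma step_pend {a b : RSeq g} {w : List T} (h : Step g a w b) :
    (∃ r ∈ g.rules, w = ruleTerms r ∧ ∃ M, pend g a = r.input ::ₘ M ∧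
      pend g b = (ruleVars r : Multiset g.NT) + M) ∨ (w = [] ∧ pend g a = pend g b) := by
  cases h with
  | ext RS r hr Aj hAj =>
    refine Or.inl ⟨r, hr, rfl, (RS.map Prod.snd).sum, ?_, ?_⟩
    · simp [pend, ← Multiset.singleton_add, add_comm]
    · have h9 := Multiset.cons_erase (Multiset.mem_coe.2 hAj)
      rw [← Multiset.singleton_add] at h9
      conv_rhs => rw [← h9]
      simp only [pend, List.map_append, List.sum_append, List.getLast?_append,
        ← Multiset.singleton_add]
      simp [-Multiset.singleton_add, -Multiset.coe_erase]
      abel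
  | extNe RS r hr v hv Aj hAj =>
    refine Or.inl ⟨r, hr, rfl, (RS.map Prod.snd).sum + v, ?_, ?_⟩
    · simp [pend, ← Multiset.singleton_add, add_comm]
    · have h9 := Multiset.cons_erase (Multiset.mem_coe.2 hAj)
      rw [← Multiset.singleton_add] at h9
      conv_rhs => rw [← h9]
      simp only [pend, List.map_append, List.sum_append, List.getLast?_append,
        ← Multiset.singleton_add]
      simp [-Multiset.singleton_add, -Multiset.coe_erase]
      abel
  | replE RS r hr ht =>
    refine Or.inl ⟨r, hr, rfl, (RS.map Prod.snd).sum, ?_, ?_⟩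
    · simp [pend, ← Multiset.singleton_add, add_comm]
    · simp [pend, ht]
  | replNe RS r hr ht v A' =>
    refine Or.inl ⟨r, hr, rfl, (RS.map Prod.snd).sum + v + {A'}, ?_, ?_⟩
    · rw [← Multiset.singleton_add]; simp [pend, -Multiset.singleton_add]; abel
    · simp [pend, ht]
  | shorten RS A v A' =>
    refine Or.inr ⟨rfl, ?_⟩
    simp [pend, ← Multiset.singleton_add, -Multiset.singleton_add, add_assoc]

lemma steps_derives {a b : RSeq g} {w : List T} (h : Steps g a w b) (ha : a = start g) :
    ∃ l, g.Derives [Symbol.nonterminal g.initial] l ∧ (sVars l : Multiset g.NT) = pend g b ∧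
      (sTerms l : Multiset T) = (w : Multiset T) := by
  induction h with
  | refl h =>
    subst ha
    exact ⟨_, .refl _, by simp [start, pend, sVars_nt], by simp [sTerms_nt]⟩
  | tail h hs h3 ih =>
    obtain ⟨l, l1, l2, l3⟩ := ih
    rcases step_pend g hs with ⟨r, hr, rfl, M, hM, hM'⟩ | ⟨rfl, hE⟩
    · have hmem : r.input ∈ sVars l := by
        have : r.input ∈ (sVars l : Multiset g.NT) := by rw [l2, hM]; simp
        simpa using this
      have hmem2 : Symbol.nonterminal r.input ∈ l := by
        obtain ⟨x, hx, hx'⟩ := List.mem_filterMap.1 hmem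
        cases x with
        | terminal a => simp at hx'
        | nonterminal B => simp at hx'; rwa [← hx']
      obtain ⟨p, q, rfl⟩ := List.append_of_mem hmem2
      have e1 : p ++ Symbol.nonterminal r.input :: q = p ++ [Symbol.nonterminal r.input] ++ q := by
        simp
      rw [e1] at l1 l2 l3
      refine ⟨p ++ r.output ++ q, l1.trans_produces ⟨r, hr, ContextFreeRule.rewrites_of_exists_parts r p q⟩, ?_, ?_⟩
      · rw [hM] at l2
        simp only [sVars_append, sVars_nt, ← Multiset.coe_add, Multiset.coe_singleton] at l2 ⊢
        have : (sVars p : Multiset g.NT) + sVars q = M := by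
          rw [← Multiset.cons_inj_right r.input, ← l2, ← Multiset.singleton_add]; abel
        rw [hM', ← this, ruleVars_eq]; abel
      · simp only [sTerms_append, sTerms_nt, ← Multiset.coe_add, Multiset.coe_nil] at l3 ⊢
        rw [← l3, ruleTerms_eq]; abel
    · exact ⟨l, l1, by rw [l2, hE], by simpa using l3⟩

lemma parikh_of_coe [DecidableEq T] {w w' : List T} (h : (w : Multiset T) = (w' : Multiset T)) :
    parikh w = parikh w' := by
  funext a
  have := congrArg (Multiset.count a) h
  simpa [parikh] using this

lemma forward [DecidableEq T] (w : List T) (hw : w ∈ g.language) :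
    ∃ w' : List T, AutAccepts g w' ∧ parikh w' = parikh w := by
  obtain ⟨f, f1, f2, f3, f4⟩ := exists_forest g w _ hw
  obtain ⟨f', k1, k2, k3, k4⟩ := Fo.exists_good (gInp g) (gVs g) (g.rules : Set _)
    g.rules.finite_toSet f f1 f2
  rw [f3, sVars_nt] at k2
  cases f' with
  | nil => simp [Fo.roots] at k2
  | cons r c s =>
    have hk := congrArg Multiset.card k2
    simp [Fo.roots] at hk
    cases s with
    | cons _ _ _ => simp [Fo.roots] at hk
    | nil =>
      have hri : r.input = g.initial := by simpa [Fo.roots] using k2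
      obtain ⟨w', h1, h2⟩ := run_fo g _ [] 0 (by simp) (by simp) k4 k1 (by rw [k3]; exact f2)
        r c .nil rfl
      refine ⟨w', ?_, parikh_of_coe ?_⟩
      · rw [hri] at h2; exact h2
      · rw [h1, ← f4, gTs, k3, sTerms_nt]; simp

lemma backward [DecidableEq T] (w : List T) (hw : AutAccepts g w) :
    ∃ w' : List T, w' ∈ g.language ∧ parikh w' = parikh w := by
  obtain ⟨l, l1, l2, l3⟩ := steps_derives g hw rfl
  have h0 : sVars l = [] := by
    have : (sVars l : Multiset g.NT) = 0 := by rw [l2]; simp [pend]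
    simpa using this
  refine ⟨sTerms l, ?_, parikh_of_coe l3⟩
  show g.Derives _ _
  rw [← eq_map_of_sVars l h0]; exact l1

end Gram

/-- If a word `w` is derivable from the axiom of `G`, then `A(G)` accepts some word
`w′` with the same Parikh image; consequently (together with the converse
direction) the language accepted by `A(G)` has exactly the same Parikh image as
`L(G)`, i.e. `A(G)` is a Parikh-equivalent automaton for `G`. -/
theorem parikh_equivalence {T : Type*} [DecidableEq T]
    (g : ContextFreeGrammar T) [DecidableEq g.NT] :
    (∀ w : List T, w ∈ g.language →
      ∃ w' : List T, AutAccepts g w' ∧ parikh w' = parikh w) ∧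
    {x : T → ℕ | ∃ w : List T, AutAccepts g w ∧ x = parikh w}
      = {x : T → ℕ | ∃ w : List T, w ∈ g.language ∧ x = parikh w} := by
  refine ⟨forward g, ?_⟩
  ext x
  constructor
  · rintro ⟨w, hw, rfl⟩
    obtain ⟨w', h1, h2⟩ := backward g w hw
    exact ⟨w', h1, h2.symm⟩
  · rintro ⟨w, hw, rfl⟩
    obtain ⟨w', h1, h2⟩ := forward g w hw
    exact ⟨w', h1, h2.symm⟩
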